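/- arXiv:2007.04061 — 2 statements merged into one kernel-verified Lean document; each statement's English description precedes it below -/
import Mathlib

section
/- Let c ∈ (0,1) and n ∈ ℕ, n ≥ 2, and set φ_n(z) = 2^{−n}(U_n(z) + √c · U_{n−1}(z)), where U_m is the Chebyshev polynomial of the second kind. Then φ_n has exactly n real zeros, all lying in the open interval (−1,1), and they interlace with the zeros of U_{n−1}: if z_1 > z_2 > ⋯ > z_n are the zeros of φ_n, then z_{k+1} < cos(kπ/n) < z_k for k = 1,…,n−1. -/
open Real

theorem phi_aux_sign (s : ℝ) (hs0 : 0 ≤ s) (hs1 : s < 1) (n : ℕ) (hn : 2 ≤ n) (k : ℕ) (hk : k ≤ n) :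
    0 < (-1 : ℝ) ^ k * ((Polynomial.Chebyshev.U ℝ (n : ℤ)).eval (cos (k * π / n)) +
        s * (Polynomial.Chebyshev.U ℝ ((n : ℤ) - 1)).eval (cos (k * π / n))) := by
  have hn0 : (0 : ℝ) < n := by exact_mod_cast (by omega : 0 < n)
  rcases Nat.eq_zero_or_pos k with rfl | hk0
  · simp only [Nat.cast_zero, zero_mul, zero_div, cos_zero, Polynomial.Chebyshev.U_eval_one]
    push_cast
    nlinarith [mul_nonneg hs0 hn0.le]
  rcases hk.eq_or_lt with rfl | hkn
  · have : (k : ℝ) * π / k = π := by field_simp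
    rw [this, cos_pi, Polynomial.Chebyshev.U_eval_neg_one, Polynomial.Chebyshev.U_eval_neg_one]
    have h1 : ((k : ℤ) - 1).negOnePow = - (k : ℤ).negOnePow := by
      rw [Int.negOnePow_sub]; simp
    have h2 : (((k : ℤ).negOnePow : ℤ) : ℝ) = (-1) ^ k := by
      simp [Int.negOnePow_def]
    rw [h1]
    push_cast
    rw [h2]
    have h3 : ((-1 : ℝ) ^ k) * (-1) ^ k = 1 := by rw [← mul_pow]; simp
    have : (-1 : ℝ) ^ k * ((-1) ^ k * ((k : ℝ) + 1) + s * (-(-1) ^ k * ((k : ℝ) - 1 + 1)))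
        = ((-1 : ℝ) ^ k * (-1) ^ k) * (k + 1 - s * k) := by ring
    rw [this, h3]
    nlinarith
  · have hk0' : (0 : ℝ) < k := by exact_mod_cast hk0
    have hkn' : (k : ℝ) < n := by exact_mod_cast hkn
    have hsin : 0 < sin (k * π / n) := by
      apply sin_pos_of_pos_of_lt_pi
      · positivity
      · rw [div_lt_iff₀ hn0]; nlinarith [pi_pos]
    have e1 := Polynomial.Chebyshev.U_real_cos (k * π / n) (n : ℤ)
    have e2 := Polynomial.Chebyshev.U_real_cos (k * π / n) ((n : ℤ) - 1)
    have a1 : (((n : ℤ) : ℝ) + 1) * (k * π / n) = k * π / n + k * π := by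
      push_cast; field_simp; ring
    have a2 : ((((n : ℤ) - 1 : ℤ) : ℝ) + 1) * (k * π / n) = k * π := by
      push_cast; field_simp; ring
    rw [a1, sin_add_nat_mul_pi] at e1
    rw [a2, sin_nat_mul_pi] at e2
    have f1 := mul_right_cancel₀ hsin.ne' e1
    have f2 := (mul_eq_zero.mp e2).resolve_right hsin.ne'
    rw [f1, f2, mul_zero, add_zero, ← mul_pow]
    simp

theorem phi_zeros_in_Ioo_and_interlace
    (c : ℝ) (hc0 : 0 < c) (hc1 : c < 1) (n : ℕ) (hn : 2 ≤ n)
    (φ : ℝ → ℝ)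
    (hφ : ∀ x : ℝ, φ x = (2 : ℝ) ^ (-(n : ℤ)) *
      ((Polynomial.Chebyshev.U ℝ (n : ℤ)).eval x +
        Real.sqrt c * (Polynomial.Chebyshev.U ℝ ((n : ℤ) - 1)).eval x)) :
    ∃ z : Fin n → ℝ, StrictAnti z ∧
      (∀ x : ℝ, φ x = 0 ↔ ∃ i, x = z i) ∧
      (∀ i, z i ∈ Set.Ioo (-1 : ℝ) 1) ∧
      ∀ k : ℕ, (hk : k + 1 < n) →
        z ⟨k + 1, hk⟩ < Real.cos ((k + 1) * π / n) ∧
          Real.cos ((k + 1) * π / n) < z ⟨k, by omega⟩ := by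
  have hn0 : (0 : ℝ) < n := by exact_mod_cast (by omega : 0 < n)
  have hs1 : Real.sqrt c < 1 := by
    rw [Real.sqrt_lt' one_pos]; simpa using hc1
  set P : Polynomial ℝ := Polynomial.Chebyshev.U ℝ (n : ℤ) +
    Polynomial.C (Real.sqrt c) * Polynomial.Chebyshev.U ℝ ((n : ℤ) - 1) with hP
  have hPe : ∀ x, P.eval x = (Polynomial.Chebyshev.U ℝ (n : ℤ)).eval x +
        Real.sqrt c * (Polynomial.Chebyshev.U ℝ ((n : ℤ) - 1)).eval x := by
    intro x; simp [hP]
  have hφP : ∀ x, φ x = 0 ↔ P.eval x = 0 := by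
    intro x
    rw [hφ, ← hPe, mul_eq_zero, or_iff_right (by positivity)]
  have hsign : ∀ k : ℕ, k ≤ n → 0 < (-1 : ℝ) ^ k * P.eval (cos (k * π / n)) := by
    intro k hk
    rw [hPe]
    exact phi_aux_sign _ (Real.sqrt_nonneg c) hs1 n hn k hk
  have hanti : ∀ i j : ℕ, i < j → j ≤ n → cos (j * π / n) < cos (i * π / n) := by
    intro i j hij hj
    have hij' : (i : ℝ) < j := by exact_mod_cast hij
    have hj' : (j : ℝ) ≤ n := by exact_mod_cast hj
    apply cos_lt_cos_of_nonneg_of_le_pi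
    · positivity
    · rw [div_le_iff₀ hn0]; nlinarith [pi_pos]
    · gcongr
  have hanti' : ∀ i j : ℕ, i ≤ j → j ≤ n → cos (j * π / n) ≤ cos (i * π / n) := by
    intro i j hij hj
    rcases hij.eq_or_lt with rfl | h
    · exact le_rfl
    · exact (hanti i j h hj).le
  have hex : ∀ i : Fin n, ∃ x, x ∈ Set.Ioo (cos (((i : ℕ) + 1 : ℕ) * π / n)) (cos ((i : ℕ) * π / n)) ∧
      P.eval x = 0 := by
    intro i
    have h1 := hsign i i.2.le
    have h2 := hsign (i + 1) i.2
    have hc : ContinuousOn (fun x => (-1 : ℝ) ^ (i : ℕ) * P.eval x)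
        (Set.Icc (cos (((i : ℕ) + 1 : ℕ) * π / n)) (cos ((i : ℕ) * π / n))) :=
      (continuous_const.mul P.continuous).continuousOn
    have := intermediate_value_Ioo (hanti i (i + 1) (Nat.lt_succ_self _) i.2).le hc
    obtain ⟨x, hx, hx0⟩ := this (show (0 : ℝ) ∈ _ from ⟨by rw [pow_succ] at h2; linarith, h1⟩)
    refine ⟨x, hx, ?_⟩
    exact (mul_eq_zero.mp hx0).resolve_left (by positivity)
  choose z hz hz0 using hex
  have hza : StrictAnti z := by
    intro i j hij
    exact ((hz j).2.trans_le (hanti' (i + 1) j hij j.2.le)).trans (hz i).1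
  refine ⟨z, hza, ?_, ?_, ?_⟩
  · have hP0 : P ≠ 0 := by
      intro h
      have := hsign 0 (by omega)
      rw [h] at this
      simp at this
    have hdeg : P.natDegree ≤ n := by
      rw [hP]
      refine Polynomial.natDegree_add_le_of_degree_le ?_ ?_
      · rw [Polynomial.Chebyshev.natDegree_U_natCast]
      · refine (Polynomial.natDegree_C_mul_le _ _).trans ?_
        have : ((n : ℤ) - 1) = ((n - 1 : ℕ) : ℤ) := by omega
        rw [this, Polynomial.Chebyshev.natDegree_U_natCast]
        omega
    have hsub : Finset.univ.image z ⊆ P.roots.toFinset := by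
      intro x hx
      obtain ⟨i, -, rfl⟩ := Finset.mem_image.mp hx
      rw [Multiset.mem_toFinset, Polynomial.mem_roots hP0]
      exact hz0 i
    have heq := Finset.eq_of_subset_of_card_le hsub (by
      rw [Finset.card_image_of_injective _ hza.injective, Finset.card_univ, Fintype.card_fin]
      exact (Multiset.toFinset_card_le _).trans ((Polynomial.card_roots' P).trans hdeg))
    intro x
    rw [hφP]
    constructor
    · intro hx
      have : x ∈ P.roots.toFinset := by
        rw [Multiset.mem_toFinset, Polynomial.mem_roots hP0]
        exact hx
      rw [← heq] at this
      obtain ⟨i, -, hi⟩ := Finset.mem_image.mp this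
      exact ⟨i, hi.symm⟩
    · rintro ⟨i, rfl⟩
      exact hz0 i
  · intro i
    exact ⟨(neg_one_le_cos _).trans_lt (hz i).1, (hz i).2.trans_le (cos_le_one _)⟩
  · intro k hk
    have h1 := (hz ⟨k + 1, hk⟩).2
    have h2 := (hz ⟨k, by omega⟩).1
    push_cast at h1 h2
    exact ⟨h1, h2⟩
end

section
/- Let c ∈ (0,1) and n ∈ ℕ, n ≥ 2, and let τ be the smallest real zero of the polynomial U_n(z) + √c · U_{n−1}(z), where U_m is the Chebyshev polynomial of the second kind. Then τ = −1 + ε_n with 1/(n(n+1)) < ε_n < 2 sin²(π/(2n)); that is, −1 + 1/(n(n+1)) < τ < −cos(π/n). -/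
open Real

lemma aux_rec (m : ℕ) (y : ℝ) :
    (Polynomial.Chebyshev.U ℝ ((m + 1 : ℕ) : ℤ)).eval y =
      2 * y * (Polynomial.Chebyshev.U ℝ (m : ℤ)).eval y -
        (Polynomial.Chebyshev.U ℝ ((m : ℤ) - 1)).eval y := by
  have h := congrArg (Polynomial.eval y) (Polynomial.Chebyshev.U_add_one ℝ (m : ℤ))
  push_cast
  rw [h]
  simp

/-- reflected values for `y ≥ 1` -/
lemma aux_ge (y : ℝ) (hy : 1 ≤ y) (k : ℕ) :
    1 ≤ (Polynomial.Chebyshev.U ℝ (k : ℤ)).eval y ∧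
    (Polynomial.Chebyshev.U ℝ ((k : ℤ) - 1)).eval y ≤
      (Polynomial.Chebyshev.U ℝ (k : ℤ)).eval y := by
  induction k with
  | zero => simp
  | succ k ih =>
    rw [aux_rec]
    push_cast
    rw [add_sub_cancel_right]
    obtain ⟨h1, h2⟩ := ih
    constructor <;> nlinarith [mul_nonneg (sub_nonneg.2 hy) (by linarith : (0:ℝ) ≤ (Polynomial.Chebyshev.U ℝ (k : ℤ)).eval y)]

lemma aux_le (n : ℕ) (d : ℝ) (hd : 0 ≤ d) (hdn : d * (n * (n + 1)) ≤ 1) (k : ℕ) (hk : k ≤ n) :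
    1 ≤ (Polynomial.Chebyshev.U ℝ (k : ℤ)).eval (1 - d) ∧
    (Polynomial.Chebyshev.U ℝ (k : ℤ)).eval (1 - d) ≤ k + 1 ∧
    (Polynomial.Chebyshev.U ℝ (k : ℤ)).eval (1 - d) -
      (Polynomial.Chebyshev.U ℝ ((k : ℤ) - 1)).eval (1 - d) ≤ 1 ∧
    1 - d * (k * (k + 1)) ≤ (Polynomial.Chebyshev.U ℝ (k : ℤ)).eval (1 - d) -
      (Polynomial.Chebyshev.U ℝ ((k : ℤ) - 1)).eval (1 - d) := by
  induction k with
  | zero => simp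
  | succ k ih =>
    obtain ⟨h1, h2, h3, h4⟩ := ih (by omega)
    rw [aux_rec]
    push_cast
    rw [add_sub_cancel_right]
    have hkn : ((k : ℝ) + 1) ≤ n := by exact_mod_cast hk
    have hk0 : (0 : ℝ) ≤ k := k.cast_nonneg
    have h5 : d * (((k : ℝ) + 1) * (k + 1 + 1)) ≤ d * (n * (n + 1)) := by gcongr
    generalize (Polynomial.Chebyshev.U ℝ (k : ℤ)).eval (1 - d) = u at *
    generalize (Polynomial.Chebyshev.U ℝ ((k : ℤ) - 1)).eval (1 - d) = v at *
    have h6 : d * u ≤ d * (k + 1) := by gcongr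
    have h7 : 0 ≤ d * u := by apply mul_nonneg hd; linarith
    refine ⟨?_, ?_, ?_, ?_⟩ <;> nlinarith

lemma aux_refl (n : ℕ) (hn : 1 ≤ n) (s y : ℝ) :
    ((Polynomial.Chebyshev.U ℝ (n : ℤ)).eval (-y) +
        s * (Polynomial.Chebyshev.U ℝ ((n : ℤ) - 1)).eval (-y) = 0) ↔
    (Polynomial.Chebyshev.U ℝ (n : ℤ)).eval y -
        s * (Polynomial.Chebyshev.U ℝ ((n : ℤ) - 1)).eval y = 0 := by
  obtain ⟨m, rfl⟩ : ∃ m, n = m + 1 := ⟨n - 1, by omega⟩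
  have e : (((m + 1 : ℕ) : ℤ) - 1) = (m : ℤ) := by push_cast; ring
  rw [e, Polynomial.Chebyshev.U_eval_neg, Polynomial.Chebyshev.U_eval_neg]
  push_cast
  rw [Int.negOnePow_succ]
  rcases Int.units_eq_one_or (m : ℤ).negOnePow with h | h <;> rw [h] <;> push_cast <;>
    constructor <;> intro h <;> linarith

theorem smallest_zero_estimate
    (c : ℝ) (hc0 : 0 < c) (hc1 : c < 1) (n : ℕ) (hn : 2 ≤ n) (τ : ℝ)
    (hτ : IsLeast {x : ℝ |
      (Polynomial.Chebyshev.U ℝ (n : ℤ)).eval x +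
        Real.sqrt c * (Polynomial.Chebyshev.U ℝ ((n : ℤ) - 1)).eval x = 0} τ) :
    -1 + 1 / (n * (n + 1)) < τ ∧ τ < -Real.cos (π / n) ∧
      1 / (n * (n + 1)) < τ + 1 ∧ τ + 1 < 2 * Real.sin (π / (2 * n)) ^ 2 := by
  have hs0 : 0 < Real.sqrt c := Real.sqrt_pos.2 hc0
  have hs1 : Real.sqrt c < 1 := by
    rw [Real.sqrt_lt' one_pos]; simpa using hc1
  generalize Real.sqrt c = s at *
  obtain ⟨hmem, hlow⟩ := hτ
  have hn2 : (2 : ℝ) ≤ n := by exact_mod_cast hn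
  have hnp : (0 : ℝ) < n * (n + 1) := by positivity
  have e : ((n : ℤ) - 1) = ((n - 1 : ℕ) : ℤ) := by omega
  have A : -1 + 1 / (n * (n + 1)) < τ := by
    by_contra! hle
    have h0 := (aux_refl n (by omega) s (-τ)).1 (by rw [neg_neg]; exact hmem)
    have key : 1 ≤ (Polynomial.Chebyshev.U ℝ ((n : ℤ) - 1)).eval (-τ) ∧
        (Polynomial.Chebyshev.U ℝ ((n : ℤ) - 1)).eval (-τ) ≤
        (Polynomial.Chebyshev.U ℝ (n : ℤ)).eval (-τ) := by
      rcases le_total 1 (-τ) with h | h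
      · refine ⟨?_, (aux_ge _ h n).2⟩
        rw [e]; exact (aux_ge _ h (n - 1)).1
      · have hd : 0 ≤ 1 + τ := by linarith
        have hdn : (1 + τ) * (n * (n + 1)) ≤ 1 := by
          rw [← le_div_iff₀ hnp]; linarith
        have a1 := aux_le n (1 + τ) hd hdn n le_rfl
        have a2 := aux_le n (1 + τ) hd hdn (n - 1) (by omega)
        rw [show 1 - (1 + τ) = -τ by ring] at a1 a2
        refine ⟨?_, by linarith [a1.2.2.2]⟩
        rw [e]; exact a2.1
    nlinarith [key.1, key.2]
  have B : τ < -Real.cos (π / n) := by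
    have hpos : 0 < π / n := by positivity
    have hlt : π / n < π := by
      apply div_lt_self Real.pi_pos; linarith
    have hsin : 0 < Real.sin (π / n) := Real.sin_pos_of_pos_of_lt_pi hpos hlt
    have hnpi : (n : ℝ) * (π / n) = π := by field_simp
    have u1 : (Polynomial.Chebyshev.U ℝ (n : ℤ)).eval (Real.cos (π / n)) = -1 := by
      have h := Polynomial.Chebyshev.U_real_cos (π / n) (n : ℤ)
      push_cast at h
      rw [add_mul, hnpi, one_mul, add_comm, Real.sin_add_pi] at h
      have : ((Polynomial.Chebyshev.U ℝ (n : ℤ)).eval (Real.cos (π / n)) + 1) *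
        Real.sin (π / n) = 0 := by linarith
      rcases mul_eq_zero.1 this with h | h <;> linarith
    have u2 : (Polynomial.Chebyshev.U ℝ ((n : ℤ) - 1)).eval (Real.cos (π / n)) = 0 := by
      have h := Polynomial.Chebyshev.U_real_cos (π / n) ((n : ℤ) - 1)
      push_cast at h
      rw [sub_add_cancel, hnpi, Real.sin_pi] at h
      rcases mul_eq_zero.1 h with h | h <;> linarith
    set f : ℝ → ℝ := fun y => (Polynomial.Chebyshev.U ℝ (n : ℤ)).eval y -
        s * (Polynomial.Chebyshev.U ℝ ((n : ℤ) - 1)).eval y with hf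
    have hc : ContinuousOn f (Set.Icc (Real.cos (π / n)) 1) := by
      apply Continuous.continuousOn
      fun_prop
    have f0 : f (Real.cos (π / n)) < 0 := by simp [hf, u1, u2]
    have f1 : 0 < f 1 := by
      simp only [hf, Polynomial.Chebyshev.U_eval_one]
      push_cast
      nlinarith
    obtain ⟨y, hy, hy0⟩ := intermediate_value_Ioo (Real.cos_le_one _) hc ⟨f0, f1⟩
    have := hlow ((aux_refl n (by omega) s y).2 hy0)
    linarith [hy.1]
  have C : 2 * Real.sin (π / (2 * n)) ^ 2 = 1 - Real.cos (π / n) := by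
    rw [show π / n = 2 * (π / (2 * n)) by field_simp, Real.cos_two_mul, Real.cos_sq']
    ring
  exact ⟨A, B, by linarith, by linarith⟩
end
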